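/- For every integer k ≥ 1 and every integer b ≥ 2 there exists a constant C > 0, depending only on k and b, such that for all L ∈ ℕ: ∑_{l : Fin k → ℕ, (∑ i, l i) ≤ L} ∏_{i} b^(l i) ≤ C · b^L · (L+1)^(k−1). -/

import Mathlib

open Finset

/-- A geometric sum with ratio at least `2` is at most twice its last term. -/
theorem geom_sum_succ_le_two_mul_pow {r : ℝ} (hr : 2 ≤ r) (L : ℕ) :
    ∑ s ∈ Finset.range (L + 1), r ^ s ≤ 2 * r ^ L := by
  induction L with
  | zero => norm_num
  | succ L ih =>
    rw [Finset.sum_range_succ]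
    have h : 2 * r ^ L ≤ r ^ (L + 1) := by
      rw [pow_succ']
      gcongr
    linarith

/-- The sum of `r ^ ‖l‖₁` over the simplex `‖l‖₁ ≤ L` in `ℕ ^ (n + 1)` is bounded by sending `l` to
the pair of `‖l‖₁` and the last `n` coordinates of `l`. -/
theorem sum_simplex_prod_pow_le {r : ℝ} (hr : 0 ≤ r) (n L : ℕ) :
    ∑ l ∈ (Fintype.piFinset fun _ : Fin (n + 1) => Finset.range (L + 1)).filter
        (fun l => ∑ i, l i ≤ L), ∏ i, r ^ (l i)
      ≤ (∑ s ∈ Finset.range (L + 1), r ^ s) * ((L : ℝ) + 1) ^ n := by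
  let f : (Fin (n + 1) → ℕ) → ℕ × (Fin n → ℕ) := fun l => (∑ i, l i, Fin.tail l)
  have hf : Function.Injective f := by
    intro l m h
    obtain ⟨hsum, htail⟩ := Prod.mk.inj h
    rw [Fin.sum_univ_succ, Fin.sum_univ_succ] at hsum
    have hsucc (i : Fin n) : l i.succ = m i.succ := congrFun htail i
    simp only [hsucc, Nat.add_right_cancel_iff] at hsum
    funext i
    exact Fin.cases hsum hsucc i
  calc
    _ = ∑ p ∈ ((Fintype.piFinset fun _ : Fin (n + 1) => Finset.range (L + 1)).filter
        (fun l => ∑ i, l i ≤ L)).image f, r ^ p.1 := by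
      rw [Finset.sum_image hf.injOn]
      exact Finset.sum_congr rfl fun l _ => Finset.prod_pow_eq_pow_sum _ _ _
    _ ≤ ∑ p ∈ Finset.range (L + 1) ×ˢ Fintype.piFinset fun _ : Fin n => Finset.range (L + 1),
        r ^ p.1 := by
      refine Finset.sum_le_sum_of_subset_of_nonneg ?_ fun _ _ _ => pow_nonneg hr _
      refine Finset.image_subset_iff.2 fun l hl => ?_
      rw [Finset.mem_filter, Fintype.mem_piFinset] at hl
      exact Finset.mem_product.2 ⟨Finset.mem_range.2 (Nat.lt_succ_of_le hl.2),
        Fintype.mem_piFinset.2 fun i => hl.1 i.succ⟩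
    _ = _ := by
      simp [Finset.sum_product, Finset.sum_mul, mul_comm]

/-- The sparse tensor product space has `O(b^L (L+1)^(k-1))` degrees of freedom:
for `k ≥ 1`, `b ≥ 2` there is `C > 0` (depending only on `k`, `b`) such that for all `L`,
`∑_{l ∈ ℕ^k, ‖l‖₁ ≤ L} ∏ᵢ b^(lᵢ) ≤ C · b^L · (L+1)^(k-1)`. -/
theorem stmt_7 (k b : ℕ) (hk : 1 ≤ k) (hb : 2 ≤ b) :
    ∃ C : ℝ, 0 < C ∧ ∀ L : ℕ,
      ∑ l ∈ (Fintype.piFinset fun _ : Fin k => Finset.range (L + 1)).filter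
          (fun l => ∑ i, l i ≤ L),
        ∏ i, (b : ℝ) ^ (l i)
      ≤ C * (b : ℝ) ^ L * ((L : ℝ) + 1) ^ (k - 1) := by
  obtain ⟨n, rfl⟩ := Nat.exists_eq_add_of_le' hk
  have hb' : (2 : ℝ) ≤ b := by exact_mod_cast hb
  refine ⟨2, two_pos, fun L => (sum_simplex_prod_pow_le (by positivity) n L).trans ?_⟩
  rw [Nat.add_sub_cancel]
  gcongr
  exact geom_sum_succ_le_two_mul_pow hb' L
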